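/- Let p ≤ q be coprime positive integers and θ = arctan(p/q). Then the dimension of μ_θ is bounded below by the pressure bound: for every Borel set A ⊆ ℝ with μ_θ(A) = 1, the Hausdorff dimension satisfies dim_H(A) ≥ (log 9 − P)/log 2, where P = limsup_{n→∞} (1/n) log( ∑_{z ∈ Z_n} exp( sup_{ω ∈ [z]} ∑_{j=0}^{n−1} φ(σ^j ω) ) ) is the topological pressure of φ on the extended line l_{p/q}. -/

import Mathlib

open MeasureTheory

/-- The four matrices `A_b` indexed by `B = {(0,0),(1,0),(0,1),(1,1)}`
(encoded as `Bool × Bool`, `false ↦ 0`, `true ↦ 1`), with real entries. -/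
def Amat : Bool × Bool → Matrix (Fin 4) (Fin 4) ℝ
  | (false, false) => !![3,1,1,1; 0,1,0,0; 0,0,1,0; 0,0,0,1]
  | (true, false)  => !![1,0,1,0; 1,3,0,1; 0,0,0,0; 0,0,1,1]
  | (false, true)  => !![1,1,0,0; 0,0,0,0; 1,0,3,1; 0,1,0,1]
  | (true, true)   => !![1,0,0,0; 0,1,0,0; 0,0,1,0; 1,1,1,3]

/-- `W(ω_1⋯ω_n) = (1,1,1,1) · A_{ω_1}⋯A_{ω_n} · (1,0,0,0)ᵀ` for the length-`n`
prefix of the sequence `ω`. -/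
def Wpre (ω : ℕ → Bool × Bool) (n : ℕ) : ℝ :=
  ∑ i : Fin 4, ((List.ofFn fun k : Fin n => Amat (ω k)).prod) i 0

/-- The potential `φ(ω) = limsup_n log( W(ω_1⋯ω_n)/W(ω_2⋯ω_n) )`. -/
noncomputable def phi (ω : ℕ → Bool × Bool) : ℝ :=
  Filter.limsup (fun n => Real.log (Wpre ω n / Wpre (fun i => ω (i + 1)) (n - 1)))
    Filter.atTop

/-- `X_θ`: sequences `ω ∈ B^ℕ` whose associated point
`(∑ ω_{i,1} 2^{-i}, ∑ ω_{i,2} 2^{-i})` lies on the extended line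
`l_{p/q} = {(t mod 1, (p/q)·t mod 1) : t ∈ ℝ}`. -/
def Xtheta (p q : ℕ) : Set (ℕ → Bool × Bool) :=
  {ω | ∃ t : ℝ,
    Int.fract t = ∑' i : ℕ, (if (ω i).1 then (1 : ℝ) else 0) / 2 ^ (i + 1) ∧
    Int.fract ((p : ℝ) / (q : ℝ) * t)
      = ∑' i : ℕ, (if (ω i).2 then (1 : ℝ) else 0) / 2 ^ (i + 1)}

/-- `Z_n`: words `z ∈ B^n` with `p·∑ z_{i,1} 2^{n-i} = q·∑ z_{i,2} 2^{n-i}`. -/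
def Zset (p q n : ℕ) : Finset (Fin n → Bool × Bool) :=
  Finset.univ.filter fun z =>
    p * ∑ i : Fin n, (if (z i).1 then 1 else 0) * 2 ^ (n - 1 - (i : ℕ))
      = q * ∑ i : Fin n, (if (z i).2 then 1 else 0) * 2 ^ (n - 1 - (i : ℕ))

/-- The topological pressure
`P = limsup (1/n) log ∑_{z ∈ Z_n} exp( sup_{ω ∈ [z]} ∑_{j<n} φ(σ^j ω) )`
of `φ` on the extended line `l_{p/q}`. -/
noncomputable def pressure (p q : ℕ) : ℝ :=
  Filter.limsup (fun n : ℕ => (1 / (n : ℝ)) * Real.log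
    (∑ z ∈ Zset p q n, Real.exp (sSup
      ((fun ω => ∑ j ∈ Finset.range n, phi fun i => ω (i + j)) ''
        {ω | ω ∈ Xtheta p q ∧ ∀ i : Fin n, ω (i : ℕ) = z i}))))
    Filter.atTop

/-- The first column of `A_{ω_1}⋯A_{ω_n}`. -/
def prodCol (ω : ℕ → Bool × Bool) (n : ℕ) (i : Fin 4) : ℝ :=
  ((List.ofFn fun k : Fin n => Amat (ω k)).prod) i 0

lemma Wpre_eq_sum_prodCol (ω : ℕ → Bool × Bool) (n : ℕ) :
    Wpre ω n = ∑ i, prodCol ω n i := rfl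

lemma prodCol_zero (ω : ℕ → Bool × Bool) (i : Fin 4) :
    prodCol ω 0 i = if i = 0 then 1 else 0 := by
  simp [prodCol, Matrix.one_apply]

lemma prodCol_succ (ω : ℕ → Bool × Bool) (n : ℕ) (i : Fin 4) :
    prodCol ω (n + 1) i = ∑ j, Amat (ω 0) i j * prodCol (fun k => ω (k + 1)) n j := by
  simp [prodCol, List.ofFn_succ, Matrix.mul_apply]

lemma Amat_nonneg (b : Bool × Bool) (i j : Fin 4) : 0 ≤ Amat b i j := by
  rcases b with ⟨_ | _, _ | _⟩ <;> fin_cases i <;> fin_cases j <;> simp [Amat]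

lemma prodCol_nonneg (ω : ℕ → Bool × Bool) (n : ℕ) (i : Fin 4) : 0 ≤ prodCol ω n i := by
  induction n generalizing ω i with
  | zero => rw [prodCol_zero]; split_ifs <;> norm_num
  | succ n ih =>
    rw [prodCol_succ]
    exact Finset.sum_nonneg fun j _ => mul_nonneg (Amat_nonneg _ _ _) (ih _ _)

lemma Wpre_succ_bounds (ω : ℕ → Bool × Bool) (n : ℕ) :
    Wpre (fun k => ω (k + 1)) n ≤ Wpre ω (n + 1) ∧
      Wpre ω (n + 1) ≤ 3 * Wpre (fun k => ω (k + 1)) n := by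
  simp only [Wpre_eq_sum_prodCol, prodCol_succ, Fin.sum_univ_four]
  have h := prodCol_nonneg (fun k => ω (k + 1)) n
  have h0 := h 0
  have h1 := h 1
  have h2 := h 2
  have h3 := h 3
  rcases ω 0 with ⟨_ | _, _ | _⟩ <;> simp [Amat] <;> constructor <;> linarith

lemma Wpre_zero (ω : ℕ → Bool × Bool) : Wpre ω 0 = 1 := by
  simp [Wpre_eq_sum_prodCol, prodCol_zero]

lemma one_le_Wpre (ω : ℕ → Bool × Bool) (n : ℕ) : 1 ≤ Wpre ω n := by
  induction n generalizing ω with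
  | zero => rw [Wpre_zero]
  | succ n ih => exact (ih _).trans (Wpre_succ_bounds ω n).1

lemma log_Wpre_ratio_mem (ω : ℕ → Bool × Bool) (n : ℕ) :
    0 ≤ Real.log (Wpre ω (n + 1) / Wpre (fun i => ω (i + 1)) n) ∧
      Real.log (Wpre ω (n + 1) / Wpre (fun i => ω (i + 1)) n) ≤ Real.log 3 := by
  obtain ⟨h1, h2⟩ := Wpre_succ_bounds ω n
  have hpos : 0 < Wpre (fun i => ω (i + 1)) n := zero_lt_one.trans_le (one_le_Wpre _ _)
  have hle : 1 ≤ Wpre ω (n + 1) / Wpre (fun i => ω (i + 1)) n := (one_le_div hpos).2 h1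
  exact ⟨Real.log_nonneg hle,
    Real.log_le_log (by linarith) ((div_le_iff₀ hpos).2 h2)⟩

lemma phi_le (ω : ℕ → Bool × Bool) : phi ω ≤ Real.log 3 := by
  have key : ∀ᶠ n in Filter.atTop,
      0 ≤ Real.log (Wpre ω n / Wpre (fun i => ω (i + 1)) (n - 1)) ∧
        Real.log (Wpre ω n / Wpre (fun i => ω (i + 1)) (n - 1)) ≤ Real.log 3 := by
    filter_upwards [Filter.eventually_ge_atTop 1] with n hn
    obtain ⟨m, rfl⟩ := Nat.exists_eq_add_of_le' hn
    exact log_Wpre_ratio_mem ω m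
  refine Filter.limsup_le_of_le ?_ (key.mono fun n h => h.2)
  exact Filter.IsBoundedUnder.isCoboundedUnder_le
    (Filter.isBoundedUnder_of_eventually_ge (key.mono fun n h => h.1))

lemma prodCol_add_of_eventually_zero (ω : ℕ → Bool × Bool) (n r : ℕ)
    (hω : ∀ i, n ≤ i → ω i = (false, false)) (i : Fin 4) :
    prodCol ω (n + r) i = 3 ^ r * prodCol ω n i := by
  induction n generalizing ω i with
  | zero =>
    rw [Nat.zero_add]
    induction r generalizing ω i with
    | zero => simp
    | succ r ih =>
      rw [prodCol_succ, hω 0 le_rfl]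
      simp only [ih (fun k => ω (k + 1)) (fun k _ => hω _ (Nat.zero_le _)), prodCol_zero,
        Fin.sum_univ_four]
      fin_cases i <;> simp [Amat, pow_succ]
      ring
  | succ n ih =>
    rw [Nat.add_right_comm n 1 r, prodCol_succ, prodCol_succ, Finset.mul_sum]
    refine Finset.sum_congr rfl fun j _ => ?_
    rw [ih (fun k => ω (k + 1)) fun k hk => hω _ (Nat.succ_le_succ hk)]
    ring

lemma Wpre_add_of_eventually_zero (ω : ℕ → Bool × Bool) (n r : ℕ)
    (hω : ∀ i, n ≤ i → ω i = (false, false)) :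
    Wpre ω (n + r) = 3 ^ r * Wpre ω n := by
  simp only [Wpre_eq_sum_prodCol, prodCol_add_of_eventually_zero ω n r hω, Finset.mul_sum]

lemma phi_of_eventually_zero (ω : ℕ → Bool × Bool) (n : ℕ)
    (hω : ∀ i, n + 1 ≤ i → ω i = (false, false)) :
    phi ω = Real.log (Wpre ω (n + 1)) - Real.log (Wpre (fun i => ω (i + 1)) n) := by
  have hpos : 0 < Wpre (fun i => ω (i + 1)) n := zero_lt_one.trans_le (one_le_Wpre _ _)
  have hpos' : 0 < Wpre ω (n + 1) := zero_lt_one.trans_le (one_le_Wpre _ _)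
  rw [← Real.log_div hpos'.ne' hpos.ne']
  refine Filter.Tendsto.limsup_eq (tendsto_const_nhds.congr' ?_)
  filter_upwards [Filter.eventually_ge_atTop (n + 1)] with m hm
  obtain ⟨r, rfl⟩ := Nat.exists_eq_add_of_le hm
  have h1 : n + 1 + r - 1 = n + r := by omega
  rw [h1, Wpre_add_of_eventually_zero ω _ r hω,
    Wpre_add_of_eventually_zero (fun i => ω (i + 1)) n r
      fun i hi => hω _ (Nat.succ_le_succ hi),
    mul_div_mul_left _ _ (by positivity)]

lemma sum_phi_of_eventually_zero (ω : ℕ → Bool × Bool) (n : ℕ)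
    (hω : ∀ i, n ≤ i → ω i = (false, false)) :
    ∑ j ∈ Finset.range n, phi (fun i => ω (i + j)) = Real.log (Wpre ω n) := by
  induction n generalizing ω with
  | zero => simp [Wpre_zero]
  | succ n ih =>
    rw [Finset.sum_range_succ']
    have := ih (fun i => ω (i + 1)) fun i hi => hω _ (Nat.succ_le_succ hi)
    simp only [Nat.add_assoc] at this
    rw [this]
    have h0 := phi_of_eventually_zero ω n hω
    simp only [Nat.add_zero]
    rw [h0]
    ring

/-- The integer with binary digits `c`, most significant digit first. -/
def wordVal {n : ℕ} (c : Fin n → ℤ) : ℤ := ∑ i, c i * 2 ^ (n - 1 - (i : ℕ))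

lemma wordVal_cons {n : ℕ} (c : Fin (n + 1) → ℤ) :
    wordVal c = c 0 * 2 ^ n + wordVal fun i => c i.succ := by
  simp only [wordVal, Fin.sum_univ_succ, Fin.val_zero, Fin.val_succ, Nat.add_sub_cancel,
    Nat.sub_zero]
  congr 1
  refine Finset.sum_congr rfl fun i _ => ?_
  rw [Nat.sub_add_eq, Nat.sub_right_comm]

lemma wordVal_bounds {n : ℕ} (c : Fin n → ℤ) (hc : ∀ i, 0 ≤ c i ∧ c i ≤ 1) :
    0 ≤ wordVal c ∧ wordVal c < 2 ^ n := by
  induction n with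
  | zero => simp [wordVal]
  | succ n ih =>
    have h := ih (fun i => c i.succ) fun i => hc _
    have h0 := hc 0
    have h2 : (0 : ℤ) < 2 ^ n := by positivity
    rw [wordVal_cons, pow_succ]
    constructor
    · nlinarith
    · nlinarith

/-- The bit `b` as an integer. -/
def bit (b : Bool) : ℤ := if b then 1 else 0

lemma bit_bounds (b : Bool) : 0 ≤ bit b ∧ bit b ≤ 1 := by
  cases b <;> simp [bit]

lemma exists_bits (n : ℕ) (m : ℤ) (h0 : 0 ≤ m) (h1 : m < 2 ^ n) :
    ∃ z : Fin n → Bool, wordVal (fun i => bit (z i)) = m := by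
  induction n generalizing m with
  | zero =>
    refine ⟨fun _ => false, ?_⟩
    simp [wordVal] at h1 ⊢
    omega
  | succ n ih =>
    rw [pow_succ] at h1
    by_cases h : m < 2 ^ n
    · obtain ⟨z, hz⟩ := ih m h0 h
      refine ⟨Fin.cons false z, ?_⟩
      rw [wordVal_cons]
      simpa [bit] using hz
    · obtain ⟨z, hz⟩ := ih (m - 2 ^ n) (by linarith) (by linarith)
      refine ⟨Fin.cons true z, ?_⟩
      rw [wordVal_cons]
      simp only [Fin.cons_zero, Fin.cons_succ, hz]
      simp [bit]

/-- The coefficient of `1` in the digit indexed by `d`. -/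
def digX (d : Fin 3) : ℤ := if d = 1 then 1 else 0

/-- The coefficient of `p/q` in the digit indexed by `d`. -/
def digY (d : Fin 3) : ℤ := if d = 2 then 1 else 0

/-- The coefficient of `1` in the point coded by `u`, scaled to an integer. -/
def wordX {n : ℕ} (u : Fin n → Fin 3) : ℤ := wordVal fun i => digX (u i)

/-- The coefficient of `p/q` in the point coded by `u`, scaled to an integer. -/
def wordY {n : ℕ} (u : Fin n → Fin 3) : ℤ := wordVal fun i => digY (u i)

lemma wordX_bounds {n : ℕ} (u : Fin n → Fin 3) : 0 ≤ wordX u ∧ wordX u < 2 ^ n :=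
  wordVal_bounds _ fun i => by unfold digX; split_ifs <;> simp

lemma wordY_bounds {n : ℕ} (u : Fin n → Fin 3) : 0 ≤ wordY u ∧ wordY u < 2 ^ n :=
  wordVal_bounds _ fun i => by unfold digY; split_ifs <;> simp

lemma wordX_cons {n : ℕ} (d : Fin 3) (u : Fin n → Fin 3) :
    wordX (Fin.cons d u : Fin (n + 1) → Fin 3) = digX d * 2 ^ n + wordX u := by
  simp [wordX, wordVal_cons]

lemma wordY_cons {n : ℕ} (d : Fin 3) (u : Fin n → Fin 3) :
    wordY (Fin.cons d u : Fin (n + 1) → Fin 3) = digY d * 2 ^ n + wordY u := by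
  simp [wordY, wordVal_cons]

lemma sum_words_succ {M : Type*} [AddCommMonoid M] (n : ℕ) (f : (Fin (n + 1) → Fin 3) → M) :
    ∑ u, f u = ∑ d : Fin 3, ∑ u : Fin n → Fin 3, f (Fin.cons d u) := by
  rw [← Fintype.sum_prod_type']
  exact (Fintype.sum_equiv (Fin.consEquiv fun _ => Fin 3) _ _ fun x => rfl).symm

/-- The number of pairs of words whose difference is `(b, a)`, the first coordinate reversed. -/
def diffCount (n : ℕ) (a b : ℤ) : ℕ :=
  ∑ u : Fin n → Fin 3, ∑ v : Fin n → Fin 3,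
    if wordY u - wordY v = a ∧ wordX v - wordX u = b then 1 else 0

lemma diffCount_succ (n : ℕ) (a b : ℤ) :
    diffCount (n + 1) a b = ∑ d : Fin 3, ∑ e : Fin 3,
      diffCount n (a - (digY d - digY e) * 2 ^ n) (b - (digX e - digX d) * 2 ^ n) := by
  unfold diffCount
  rw [sum_words_succ]
  refine Finset.sum_congr rfl fun d _ => ?_
  rw [Finset.sum_comm' (t' := Finset.univ) (s' := fun _ => Finset.univ) (by simp)]
  rw [sum_words_succ]
  refine Finset.sum_congr rfl fun e _ => ?_
  rw [Finset.sum_comm]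
  refine Finset.sum_congr rfl fun u _ => Finset.sum_congr rfl fun v _ => ?_
  simp only [wordX_cons, wordY_cons]
  congr 1
  apply propext
  constructor <;> rintro ⟨h1, h2⟩ <;> constructor <;> linarith

lemma diffCount_eq_zero (n : ℕ) (a b : ℤ)
    (h : a ≤ -2 ^ n ∨ 2 ^ n ≤ a ∨ b ≤ -2 ^ n ∨ 2 ^ n ≤ b) : diffCount n a b = 0 := by
  refine Finset.sum_eq_zero fun u _ => Finset.sum_eq_zero fun v _ => if_neg ?_
  rintro ⟨h1, h2⟩
  have := wordX_bounds u
  have := wordX_bounds v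
  have := wordY_bounds u
  have := wordY_bounds v
  omega

lemma diffCount_zero (a b : ℤ) : diffCount 0 a b = if a = 0 ∧ b = 0 then 1 else 0 := by
  simp [diffCount, wordX, wordY, wordVal, eq_comm]

/-- First carry of the state `i`. -/
def carryX (i : Fin 4) : ℤ := if i = 1 ∨ i = 3 then 1 else 0

/-- Second carry of the state `i`. -/
def carryY (i : Fin 4) : ℤ := if i = 2 ∨ i = 3 then 1 else 0

lemma prodCol_eq_diffCount (ω : ℕ → Bool × Bool) (n : ℕ) (i : Fin 4) :
    prodCol ω n i = diffCount n
      (wordVal (fun k : Fin n => bit (ω k).1) - carryX i * 2 ^ n)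
      (wordVal (fun k : Fin n => bit (ω k).2) - carryY i * 2 ^ n) := by
  induction n generalizing ω i with
  | zero =>
    rw [prodCol_zero, diffCount_zero]
    fin_cases i <;> simp [wordVal, carryX, carryY]
  | succ n ih =>
    rw [prodCol_succ, diffCount_succ]
    simp only [ih]
    simp only [wordVal_cons, Fin.val_zero, Fin.val_succ]
    have hA := wordVal_bounds (fun k : Fin n => bit (ω (k + 1)).1) fun k => bit_bounds _
    have hB := wordVal_bounds (fun k : Fin n => bit (ω (k + 1)).2) fun k => bit_bounds _
    generalize wordVal (fun k : Fin n => bit (ω (k + 1)).1) = A at *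
    generalize wordVal (fun k : Fin n => bit (ω (k + 1)).2) = B at *
    obtain ⟨E, hE⟩ : ∃ E : ℤ → ℤ → ℕ,
        E = fun k l => diffCount n (A - k * 2 ^ n) (B - l * 2 ^ n) := ⟨_, rfl⟩
    have hEz : ∀ k l, (k ≤ -1 ∨ 2 ≤ k ∨ l ≤ -1 ∨ 2 ≤ l) → E k l = 0 := by
      intro k l h
      rw [hE]
      apply diffCount_eq_zero
      have h2 : (0 : ℤ) < 2 ^ n := by positivity
      rcases h with h | h | h | h
      · right; left; nlinarith
      · left; nlinarith
      · right; right; right; nlinarith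
      · right; right; left; nlinarith
    have e1 : ∀ j : Fin 4, diffCount n (A - carryX j * 2 ^ n) (B - carryY j * 2 ^ n)
        = E (carryX j) (carryY j) := fun j => by rw [hE]
    have e2 : ∀ x y s t u v : ℤ,
        diffCount n (x * 2 ^ n + A - s * 2 ^ (n + 1) - u * 2 ^ n)
          (y * 2 ^ n + B - t * 2 ^ (n + 1) - v * 2 ^ n)
        = E (2 * s - x + u) (2 * t - y + v) := by
      intro x y s t u v
      rw [hE]
      congr 1 <;> ring
    simp only [e1, e2]
    clear e1 e2 hE hA hB
    have hX : digX 0 = 0 ∧ digX 1 = 1 ∧ digX 2 = 0 := by decide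
    have hY : digY 0 = 0 ∧ digY 1 = 0 ∧ digY 2 = 1 := by decide
    have hcX : carryX 0 = 0 ∧ carryX 1 = 1 ∧ carryX 2 = 0 ∧ carryX 3 = 1 := by decide
    have hcY : carryY 0 = 0 ∧ carryY 1 = 0 ∧ carryY 2 = 1 ∧ carryY 3 = 1 := by decide
    obtain ⟨hX0, hX1, hX2⟩ := hX
    obtain ⟨hY0, hY1, hY2⟩ := hY
    obtain ⟨hcX0, hcX1, hcX2, hcX3⟩ := hcX
    obtain ⟨hcY0, hcY1, hcY2, hcY3⟩ := hcY
    simp only [Fin.sum_univ_three, Fin.sum_univ_four, hX0, hX1, hX2, hY0, hY1, hY2,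
      hcX0, hcX1, hcX2, hcX3, hcY0, hcY1, hcY2, hcY3]
    rcases ω 0 with ⟨_ | _, _ | _⟩ <;> fin_cases i <;>
      simp [Amat, bit, hcX0, hcX1, hcX2, hcX3, hcY0, hcY1, hcY2, hcY3, hEz] <;> ring

/-- `q · 2^n` times the projected point coded by the word `u`. -/
def wordProj (p q : ℕ) {n : ℕ} (u : Fin n → Fin 3) : ℤ := q * wordX u + p * wordY u

/-- The number of pairs of words of length `n` with the same projection. -/
def collisions (p q n : ℕ) : ℕ :=
  ∑ u : Fin n → Fin 3, ∑ v : Fin n → Fin 3, if wordProj p q u = wordProj p q v then 1 else 0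

/-- Extension of a finite word by zeros. -/
def extendZero {n : ℕ} (z : Fin n → Bool × Bool) (i : ℕ) : Bool × Bool :=
  if h : i < n then z ⟨i, h⟩ else (false, false)

lemma extendZero_val {n : ℕ} (z : Fin n → Bool × Bool) (i : Fin n) :
    extendZero z (i : ℕ) = z i := by
  simp [extendZero]

lemma extendZero_of_le {n : ℕ} (z : Fin n → Bool × Bool) (i : ℕ) (h : n ≤ i) :
    extendZero z i = (false, false) := by
  simp [extendZero, h]

lemma diffCount_le_Wpre {n : ℕ} (z : Fin n → Bool × Bool) :
    (diffCount n (wordVal fun i => bit (z i).1) (wordVal fun i => bit (z i).2) : ℝ)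
      ≤ Wpre (extendZero z) n := by
  have h := prodCol_eq_diffCount (extendZero z) n 0
  have hX : carryX 0 = 0 := rfl
  have hY : carryY 0 = 0 := rfl
  simp only [extendZero_val, hX, hY, zero_mul, sub_zero] at h
  rw [← h, Wpre_eq_sum_prodCol]
  exact Finset.single_le_sum (f := fun i => prodCol (extendZero z) n i)
    (fun i _ => prodCol_nonneg _ _ _) (Finset.mem_univ 0)

lemma natCast_wordVal {n : ℕ} (b : Fin n → Bool) :
    ((∑ i : Fin n, (if b i then 1 else 0) * 2 ^ (n - 1 - (i : ℕ)) : ℕ) : ℤ)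
      = wordVal fun i => bit (b i) := by
  simp [wordVal, bit]

lemma mem_Zset_iff (p q n : ℕ) (z : Fin n → Bool × Bool) :
    z ∈ Zset p q n ↔
      (p : ℤ) * wordVal (fun i => bit (z i).1) = q * wordVal (fun i => bit (z i).2) := by
  rw [← natCast_wordVal, ← natCast_wordVal, Zset, Finset.mem_filter]
  simp only [Finset.mem_univ, true_and]
  exact_mod_cast Iff.rfl

lemma collisions_le_sum_diffCount (p q n : ℕ) (hq : 0 < q) :
    collisions p q n ≤ 2 * ∑ z ∈ Zset p q n,
      diffCount n (wordVal fun i => bit (z i).1) (wordVal fun i => bit (z i).2) := by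
  have hhalf : ∑ u : Fin n → Fin 3, ∑ v : Fin n → Fin 3,
      (if wordProj p q u = wordProj p q v ∧ wordY v ≤ wordY u then 1 else 0)
      ≤ ∑ z ∈ Zset p q n,
        diffCount n (wordVal fun i => bit (z i).1) (wordVal fun i => bit (z i).2) := by
    unfold diffCount
    rw [Finset.sum_comm (s := Zset p q n)]
    refine Finset.sum_le_sum fun u _ => ?_
    rw [Finset.sum_comm (s := Zset p q n)]
    refine Finset.sum_le_sum fun v _ => ?_
    split_ifs with h
    · obtain ⟨h1, h2⟩ := h
      have hu := wordX_bounds u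
      have hv := wordX_bounds v
      have hu' := wordY_bounds u
      have hv' := wordY_bounds v
      unfold wordProj at h1
      have hrel : (p : ℤ) * (wordY u - wordY v) = q * (wordX v - wordX u) := by linarith
      have hb : 0 ≤ wordX v - wordX u := by
        have : 0 ≤ (q : ℤ) * (wordX v - wordX u) := by
          rw [← hrel]
          exact mul_nonneg (Int.natCast_nonneg p) (by linarith)
        exact nonneg_of_mul_nonneg_right this (by exact_mod_cast hq)
      obtain ⟨a, ha⟩ := exists_bits n (wordY u - wordY v) (by linarith) (by linarith)
      obtain ⟨b, hb⟩ := exists_bits n (wordX v - wordX u) hb (by linarith)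
      have hz : (fun i => (a i, b i)) ∈ Zset p q n := by
        rw [mem_Zset_iff]
        simp only [ha, hb, hrel]
      refine le_trans ?_ (Finset.single_le_sum (fun _ _ => Nat.zero_le _) hz)
      simp [ha, hb]
    · exact Nat.zero_le _
  have hsymm : ∑ u : Fin n → Fin 3, ∑ v : Fin n → Fin 3,
      (if wordProj p q u = wordProj p q v ∧ wordY u ≤ wordY v then 1 else 0)
      = ∑ u : Fin n → Fin 3, ∑ v : Fin n → Fin 3,
      (if wordProj p q u = wordProj p q v ∧ wordY v ≤ wordY u then 1 else 0) := by
    rw [Finset.sum_comm]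
    simp only [eq_comm]
  have hsplit : collisions p q n ≤ ∑ u : Fin n → Fin 3, ∑ v : Fin n → Fin 3,
      (if wordProj p q u = wordProj p q v ∧ wordY v ≤ wordY u then 1 else 0)
      + ∑ u : Fin n → Fin 3, ∑ v : Fin n → Fin 3,
      (if wordProj p q u = wordProj p q v ∧ wordY u ≤ wordY v then 1 else 0) := by
    simp only [collisions, ← Finset.sum_add_distrib]
    refine Finset.sum_le_sum fun u _ => Finset.sum_le_sum fun v _ => ?_
    rcases le_total (wordY u) (wordY v) with h | h <;> simp [h]
  omega

lemma tsum_bits_extendZero {n : ℕ} (b : ℕ → Bool) (hb : ∀ i, n ≤ i → b i = false) :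
    ∑' i : ℕ, (if b i then (1 : ℝ) else 0) / 2 ^ (i + 1)
      = (wordVal fun i : Fin n => bit (b i)) / 2 ^ n := by
  rw [tsum_eq_sum (s := Finset.range n)]
  · rw [← Fin.sum_univ_eq_sum_range (fun i => (if b i then (1 : ℝ) else 0) / 2 ^ (i + 1)),
      wordVal, Int.cast_sum, Finset.sum_div]
    refine Finset.sum_congr rfl fun i _ => ?_
    have h : (2 : ℝ) ^ n = 2 ^ (n - 1 - (i : ℕ)) * 2 ^ ((i : ℕ) + 1) := by
      rw [← pow_add]
      congr 1
      omega
    rw [h]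
    simp only [bit, Int.cast_mul, Int.cast_pow, Int.cast_ofNat]
    rw [mul_comm, mul_div_mul_left _ _ (by positivity)]
    split_ifs <;> simp
  · intro i hi
    rw [hb i (by simpa using hi)]
    simp

lemma extendZero_mem_Xtheta (p q n : ℕ) (hq : 0 < q) (z : Fin n → Bool × Bool)
    (hz : z ∈ Zset p q n) : extendZero z ∈ Xtheta p q := by
  rw [mem_Zset_iff] at hz
  have hA := wordVal_bounds (fun i => bit (z i).1) fun _ => bit_bounds _
  have hB := wordVal_bounds (fun i => bit (z i).2) fun _ => bit_bounds _
  have h1 := tsum_bits_extendZero (n := n) (fun i => (extendZero z i).1)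
    fun i hi => by simp [extendZero_of_le z i hi]
  have h2 := tsum_bits_extendZero (n := n) (fun i => (extendZero z i).2)
    fun i hi => by simp [extendZero_of_le z i hi]
  simp only [extendZero_val] at h1 h2
  refine ⟨(wordVal fun i => bit (z i).1) / 2 ^ n, ?_, ?_⟩
  · rw [h1, Int.fract_eq_self]
    generalize wordVal (fun i => bit (z i).1) = A at *
    have h3 : (0 : ℝ) ≤ A := by exact_mod_cast hA.1
    have h4 : (A : ℝ) < 2 ^ n := by exact_mod_cast hA.2
    exact ⟨by positivity, (div_lt_one (by positivity)).2 h4⟩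
  · rw [h2]
    generalize wordVal (fun i => bit (z i).1) = A at *
    generalize wordVal (fun i => bit (z i).2) = B at *
    have hz' : (p : ℝ) * A = q * B := by exact_mod_cast hz
    have hq' : (q : ℝ) ≠ 0 := by positivity
    have h5 : (p : ℝ) / q * (A / 2 ^ n) = B / 2 ^ n := by
      field_simp
      linarith
    rw [h5, Int.fract_eq_self]
    have h3 : (0 : ℝ) ≤ B := by exact_mod_cast hB.1
    have h4 : (B : ℝ) < 2 ^ n := by exact_mod_cast hB.2
    exact ⟨by positivity, (div_lt_one (by positivity)).2 h4⟩

/-- The sum over `Z_n` whose exponential growth rate is the pressure. -/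
noncomputable def partitionSum (p q n : ℕ) : ℝ :=
  ∑ z ∈ Zset p q n, Real.exp (sSup
      ((fun ω => ∑ j ∈ Finset.range n, phi fun i => ω (i + j)) ''
        {ω | ω ∈ Xtheta p q ∧ ∀ i : Fin n, ω (i : ℕ) = z i}))

lemma sum_phi_le (ω : ℕ → Bool × Bool) (n : ℕ) :
    ∑ j ∈ Finset.range n, phi (fun i => ω (i + j)) ≤ n * Real.log 3 := by
  refine (Finset.sum_le_card_nsmul _ _ _ fun j _ => phi_le _).trans ?_
  simp

lemma Wpre_le_exp_sSup (p q n : ℕ) (hq : 0 < q) (z : Fin n → Bool × Bool)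
    (hz : z ∈ Zset p q n) :
    Wpre (extendZero z) n ≤ Real.exp (sSup
      ((fun ω => ∑ j ∈ Finset.range n, phi fun i => ω (i + j)) ''
        {ω | ω ∈ Xtheta p q ∧ ∀ i : Fin n, ω (i : ℕ) = z i})) := by
  rw [← Real.log_le_iff_le_exp (zero_lt_one.trans_le (one_le_Wpre _ _)),
    ← sum_phi_of_eventually_zero _ _ (extendZero_of_le z)]
  refine le_csSup ⟨n * Real.log 3, ?_⟩
    ⟨extendZero z, ⟨extendZero_mem_Xtheta p q n hq z hz, extendZero_val z⟩, rfl⟩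
  rintro _ ⟨ω, -, rfl⟩
  exact sum_phi_le ω n

lemma collisions_le_partitionSum (p q n : ℕ) (hq : 0 < q) :
    (collisions p q n : ℝ) ≤ 2 * partitionSum p q n := by
  have h : (collisions p q n : ℝ) ≤ _ := Nat.cast_le.2 (collisions_le_sum_diffCount p q n hq)
  refine h.trans ?_
  push_cast
  unfold partitionSum
  gcongr with z hz
  exact (diffCount_le_Wpre z).trans (Wpre_le_exp_sSup p q n hq z hz)

lemma partitionSum_le (p q n : ℕ) : partitionSum p q n ≤ 12 ^ n := by
  have h3 : 0 ≤ Real.log 3 := Real.log_nonneg (by norm_num)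
  have hterm : ∀ z ∈ Zset p q n, Real.exp (sSup
      ((fun ω => ∑ j ∈ Finset.range n, phi fun i => ω (i + j)) ''
        {ω | ω ∈ Xtheta p q ∧ ∀ i : Fin n, ω (i : ℕ) = z i})) ≤ 3 ^ n := by
    intro z _
    rw [← Real.exp_log (show (0 : ℝ) < 3 ^ n by positivity), Real.exp_le_exp, Real.log_pow]
    refine Real.sSup_le ?_ (by positivity)
    rintro _ ⟨ω, -, rfl⟩
    exact sum_phi_le ω n
  refine (Finset.sum_le_card_nsmul _ _ _ hterm).trans ?_
  have hcard : (Zset p q n).card ≤ 4 ^ n := by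
    refine (Finset.card_le_univ _).trans ?_
    simp
  rw [nsmul_eq_mul]
  calc ((Zset p q n).card : ℝ) * 3 ^ n ≤ 4 ^ n * 3 ^ n := by
        gcongr
        exact_mod_cast hcard
    _ = 12 ^ n := by rw [← mul_pow]; norm_num

lemma one_le_collisions (p q n : ℕ) : 1 ≤ collisions p q n := by
  unfold collisions
  refine le_trans ?_ (Finset.single_le_sum (fun _ _ => Nat.zero_le _)
    (Finset.mem_univ (fun _ => 0)))
  refine le_trans ?_ (Finset.single_le_sum (fun _ _ => Nat.zero_le _)
    (Finset.mem_univ (fun _ => 0)))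
  simp

lemma eventually_collisions_le (p q : ℕ) (hq : 0 < q) (c : ℝ) (hc : pressure p q < c) :
    ∀ᶠ n : ℕ in Filter.atTop, (collisions p q n : ℝ) ≤ 2 * Real.exp (c * n) := by
  have hpos : ∀ n, 0 < partitionSum p q n := fun n => by
    have h1 : (1 : ℝ) ≤ collisions p q n := by exact_mod_cast one_le_collisions p q n
    linarith [collisions_le_partitionSum p q n hq]
  have hbdd : Filter.IsBoundedUnder (· ≤ ·) Filter.atTop
      (fun n : ℕ => (1 / (n : ℝ)) * Real.log (partitionSum p q n)) := by
    refine Filter.isBoundedUnder_of_eventually_le (a := Real.log 12) ?_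
    filter_upwards [Filter.eventually_gt_atTop 0] with n hn
    have hn' : (0 : ℝ) < n := by exact_mod_cast hn
    rw [one_div, inv_mul_le_iff₀ hn', ← Real.log_pow]
    exact Real.log_le_log (hpos n) (partitionSum_le p q n)
  have hlt : ∀ᶠ n : ℕ in Filter.atTop,
      (1 / (n : ℝ)) * Real.log (partitionSum p q n) < c :=
    Filter.eventually_lt_of_limsup_lt hc hbdd
  filter_upwards [hlt, Filter.eventually_gt_atTop 0] with n h hn
  have hn' : (0 : ℝ) < n := by exact_mod_cast hn
  rw [one_div, inv_mul_lt_iff₀ hn', mul_comm] at h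
  refine (collisions_le_partitionSum p q n hq).trans ?_
  have := (Real.log_le_iff_le_exp (hpos n)).1 h.le
  linarith

lemma sum_shifted_fiber_le {ι : Type*} [Fintype ι] (K : ι → ℤ) (j : ℤ) :
    ∑ u, ∑ v, (if K u - K v = j then 1 else 0) ≤ ∑ u, ∑ v, if K u = K v then 1 else 0 := by
  obtain ⟨f, hf⟩ : ∃ f : ℤ → ℕ, f = fun m => ∑ v, if m = K v then 1 else 0 := ⟨_, rfl⟩
  have hfz : ∀ m, f m ≠ 0 → m ∈ Finset.univ.image K := by
    intro m hm
    rw [hf] at hm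
    obtain ⟨v, -, hv⟩ := Finset.exists_ne_zero_of_sum_ne_zero hm
    simp only [ne_eq, ite_eq_right_iff, one_ne_zero, imp_false, not_not] at hv
    exact Finset.mem_image.2 ⟨v, Finset.mem_univ v, hv.symm⟩
  have hfib : ∀ g : ℤ → ℕ, ∑ u, g (K u) = ∑ m ∈ Finset.univ.image K, f m * g m := by
    intro g
    rw [Finset.sum_comp]
    refine Finset.sum_congr rfl fun m _ => ?_
    rw [hf, Finset.card_filter, smul_eq_mul]
    simp only [eq_comm]
  have h1 : ∑ u, ∑ v, (if K u - K v = j then 1 else 0)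
      = ∑ m ∈ Finset.univ.image K, f m * f (m - j) := by
    rw [← hfib (fun m => f (m - j))]
    refine Finset.sum_congr rfl fun u _ => ?_
    rw [hf]
    refine Finset.sum_congr rfl fun v _ => ?_
    congr 1
    apply propext
    constructor <;> intro h <;> linarith
  have h2 : ∑ u, ∑ v, (if K u = K v then 1 else 0)
      = ∑ m ∈ Finset.univ.image K, f m * f m := by
    rw [← hfib f, hf]
  have h3 : ∑ m ∈ Finset.univ.image K, f (m - j) * f (m - j)
      ≤ ∑ m ∈ Finset.univ.image K, f m * f m := by
    rw [← Finset.sum_image (s := Finset.univ.image K) (g := fun m => m - j)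
      (f := fun m => f m * f m) (fun a _ b _ h => by simpa using h)]
    refine Finset.sum_le_sum_of_ne_zero fun m _ hm => hfz m fun h => hm (by rw [h, zero_mul])
  have h4 : 2 * ∑ m ∈ Finset.univ.image K, f m * f (m - j)
      ≤ ∑ m ∈ Finset.univ.image K, f m * f m
        + ∑ m ∈ Finset.univ.image K, f (m - j) * f (m - j) := by
    rw [Finset.mul_sum, ← Finset.sum_add_distrib]
    refine Finset.sum_le_sum fun m _ => ?_
    have := two_mul_le_add_sq (f m) (f (m - j))
    nlinarith
  omega

lemma sum_close_le (p q n : ℕ) (hq : 0 < q) (t : ℝ) :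
    ∑ u : Fin n → Fin 3, ∑ v : Fin n → Fin 3,
      (if |t + ((wordProj p q u : ℝ) - wordProj p q v) / q| ≤ 1 then 1 else 0)
      ≤ (2 * q + 1) * collisions p q n := by
  have hq' : (0 : ℝ) < q := by exact_mod_cast hq
  have hcard : (Finset.Icc ⌈-(q : ℝ) - q * t⌉ ⌊(q : ℝ) - q * t⌋).card ≤ 2 * q + 1 := by
    rw [Int.card_Icc, Int.toNat_le]
    have h1 := Int.floor_le ((q : ℝ) - q * t)
    have h2 := Int.le_ceil (-(q : ℝ) - q * t)
    have h3 : ((⌊(q : ℝ) - q * t⌋ + 1 - ⌈-(q : ℝ) - q * t⌉ : ℤ) : ℝ) ≤ ((2 * q + 1 : ℕ) : ℤ) := by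
      push_cast
      linarith
    exact_mod_cast h3
  calc _ ≤ ∑ u : Fin n → Fin 3, ∑ v : Fin n → Fin 3,
        ∑ j ∈ Finset.Icc ⌈-(q : ℝ) - q * t⌉ ⌊(q : ℝ) - q * t⌋,
          (if wordProj p q u - wordProj p q v = j then 1 else 0) := by
        refine Finset.sum_le_sum fun u _ => Finset.sum_le_sum fun v _ => ?_
        rw [Finset.sum_ite_eq]
        split_ifs with h h'
        · exact le_rfl
        · refine absurd (Finset.mem_Icc.2 ?_) h'
          have h1 : t + ((wordProj p q u : ℝ) - wordProj p q v) / q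
              = (q * t + ((wordProj p q u : ℝ) - wordProj p q v)) / q := by
            field_simp
          rw [h1, abs_le, le_div_iff₀ hq', div_le_iff₀ hq'] at h
          rw [Int.ceil_le, Int.le_floor]
          push_cast
          constructor <;> linarith [h.1, h.2]
        · exact Nat.zero_le _
        · exact Nat.zero_le _
    _ = ∑ j ∈ Finset.Icc ⌈-(q : ℝ) - q * t⌉ ⌊(q : ℝ) - q * t⌋,
        ∑ u : Fin n → Fin 3, ∑ v : Fin n → Fin 3,
          (if wordProj p q u - wordProj p q v = j then 1 else 0) := by
        rw [Finset.sum_comm (s := Finset.Icc _ _)]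
        refine Finset.sum_congr rfl fun u _ => ?_
        rw [Finset.sum_comm]
    _ ≤ ∑ j ∈ Finset.Icc ⌈-(q : ℝ) - q * t⌉ ⌊(q : ℝ) - q * t⌋, collisions p q n :=
        Finset.sum_le_sum fun j _ => sum_shifted_fiber_le _ j
    _ ≤ _ := by
        rw [Finset.sum_const, smul_eq_mul]
        exact Nat.mul_le_mul_right _ hcard

open scoped ENNReal

lemma image_two_mul_sub (A : Set ℝ) (c : ℝ) :
    (fun x => 2 * x - c) '' A = (fun x => (x + c) / 2) ⁻¹' A := by
  ext y
  constructor
  · rintro ⟨x, hx, rfl⟩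
    simpa using hx
  · intro hy
    exact ⟨(y + c) / 2, hy, by ring⟩

lemma lintegral_self_similar (p q : ℕ) (hq : 0 < q) (μ : Measure ℝ)
    (hself : ∀ A : Set ℝ, MeasurableSet A →
      μ A = (1 / 3) * (μ ((fun x => 2 * x) '' A) + μ ((fun x => 2 * x - 1) '' A)
        + μ ((fun x => 2 * x - (p : ℝ) / (q : ℝ)) '' A)))
    (g : ℝ → ℝ≥0∞) (hg : Measurable g) :
    ∫⁻ x, g x ∂μ = 3⁻¹ * ∑ d : Fin 3,
      ∫⁻ x, g ((x + (q * digX d + p * digY d) / q) / 2) ∂μ := by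
  have hq' : (q : ℝ) ≠ 0 := by positivity
  have hmeas : ∀ c : ℝ, Measurable fun x : ℝ => (x + c) / 2 := fun c => by fun_prop
  have hμ : μ = (3⁻¹ : ℝ≥0∞) • ∑ d : Fin 3,
      μ.map (fun x => (x + ((q : ℝ) * digX d + p * digY d) / q) / 2) := by
    ext A hA
    rw [hself A hA]
    have h0 := image_two_mul_sub A 0
    simp only [sub_zero] at h0
    rw [h0, image_two_mul_sub, image_two_mul_sub]
    simp [Fin.sum_univ_three, Measure.map_apply (hmeas _) hA, digX, digY, hq']
    rw [Measure.map_apply (by fun_prop) hA, mul_add, mul_add]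
  conv_lhs => rw [hμ]
  rw [lintegral_smul_measure, lintegral_finsetSum_measure, smul_eq_mul]
  congr 1
  refine Finset.sum_congr rfl fun d _ => ?_
  rw [lintegral_map hg (hmeas _)]

lemma lintegral_self_similar_iterate (p q : ℕ) (hq : 0 < q) (μ : Measure ℝ)
    (hself : ∀ A : Set ℝ, MeasurableSet A →
      μ A = (1 / 3) * (μ ((fun x => 2 * x) '' A) + μ ((fun x => 2 * x - 1) '' A)
        + μ ((fun x => 2 * x - (p : ℝ) / (q : ℝ)) '' A)))
    (n : ℕ) (g : ℝ → ℝ≥0∞) (hg : Measurable g) :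
    ∫⁻ x, g x ∂μ = (3⁻¹) ^ n * ∑ u : Fin n → Fin 3,
      ∫⁻ x, g ((x + (wordProj p q u : ℝ) / q) / 2 ^ n) ∂μ := by
  have hq' : (q : ℝ) ≠ 0 := by positivity
  induction n generalizing g with
  | zero => simp [wordProj, wordX, wordY, wordVal]
  | succ n ih =>
    rw [lintegral_self_similar p q hq μ hself g hg, sum_words_succ, pow_succ', mul_assoc,
      Finset.mul_sum (a := (3⁻¹ : ℝ≥0∞) ^ n)]
    congr 1
    refine Finset.sum_congr rfl fun d _ => ?_
    rw [ih (fun y => g ((y + ((q : ℝ) * digX d + p * digY d) / q) / 2))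
      (hg.comp (by fun_prop))]
    congr 1
    refine Finset.sum_congr rfl fun u _ => lintegral_congr fun x => ?_
    congr 1
    simp only [wordProj, wordX_cons, wordY_cons]
    push_cast
    field_simp
    ring

lemma lintegral_closedBall_le (p q : ℕ) (hq : 0 < q) (μ : Measure ℝ) [IsProbabilityMeasure μ]
    (hself : ∀ A : Set ℝ, MeasurableSet A →
      μ A = (1 / 3) * (μ ((fun x => 2 * x) '' A) + μ ((fun x => 2 * x - 1) '' A)
        + μ ((fun x => 2 * x - (p : ℝ) / (q : ℝ)) '' A)))
    (n : ℕ) :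
    ∫⁻ x, μ (Metric.closedBall x ((2 : ℝ) ^ n)⁻¹) ∂μ
      ≤ (9⁻¹) ^ n * ((2 * q + 1) * collisions p q n : ℕ) := by
  have hS : MeasurableSet {z : ℝ × ℝ | |z.1 - z.2| ≤ ((2 : ℝ) ^ n)⁻¹} :=
    measurableSet_le (by fun_prop) (by fun_prop)
  obtain ⟨G, hGdef⟩ : ∃ G : ℝ → ℝ → ℝ≥0∞,
      G = fun x y => if |x - y| ≤ ((2 : ℝ) ^ n)⁻¹ then 1 else 0 := ⟨_, rfl⟩
  have hG : Measurable fun z : ℝ × ℝ => G z.1 z.2 := by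
    rw [hGdef]
    exact Measurable.ite hS measurable_const measurable_const
  have hball : ∀ x, μ (Metric.closedBall x ((2 : ℝ) ^ n)⁻¹) = ∫⁻ y, G x y ∂μ := by
    intro x
    rw [← lintegral_indicator_one Metric.isClosed_closedBall.measurableSet, hGdef]
    refine lintegral_congr fun y => ?_
    simp [Set.indicator, Metric.mem_closedBall, Real.dist_eq, abs_sub_comm y x]
  have hGshift : ∀ a b : ℝ, Measurable fun z : ℝ × ℝ =>
      G ((z.1 + a) / 2 ^ n) ((z.2 + b) / 2 ^ n) := fun a b =>
    hG.comp (((measurable_fst.add_const a).div_const _).prodMk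
      ((measurable_snd.add_const b).div_const _))
  have h1 : ∀ x, ∫⁻ y, G x y ∂μ = (3⁻¹) ^ n * ∑ v : Fin n → Fin 3,
      ∫⁻ y, G x ((y + (wordProj p q v : ℝ) / q) / 2 ^ n) ∂μ := fun x =>
    lintegral_self_similar_iterate p q hq μ hself n _ (hG.comp measurable_prodMk_left)
  simp only [hball]
  rw [lintegral_self_similar_iterate p q hq μ hself n _ hG.lintegral_prod_right']
  simp only [h1]
  have h2 : ∀ u : Fin n → Fin 3, ∫⁻ x, (3⁻¹) ^ n * ∑ v : Fin n → Fin 3,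
      ∫⁻ y, G ((x + (wordProj p q u : ℝ) / q) / 2 ^ n)
        ((y + (wordProj p q v : ℝ) / q) / 2 ^ n) ∂μ ∂μ
      = (3⁻¹) ^ n * ∑ v : Fin n → Fin 3, ∫⁻ x, ∫⁻ y,
        G ((x + (wordProj p q u : ℝ) / q) / 2 ^ n)
          ((y + (wordProj p q v : ℝ) / q) / 2 ^ n) ∂μ ∂μ := by
    intro u
    have hm : ∀ v : Fin n → Fin 3, Measurable fun x => ∫⁻ y,
        G ((x + (wordProj p q u : ℝ) / q) / 2 ^ n)
          ((y + (wordProj p q v : ℝ) / q) / 2 ^ n) ∂μ := fun v =>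
      (hGshift _ _).lintegral_prod_right'
    rw [lintegral_const_mul _ (Finset.measurable_fun_sum _ fun v _ => hm v),
      lintegral_finsetSum _ fun v _ => hm v]
  simp only [h2]
  rw [← Finset.mul_sum, ← mul_assoc, ← mul_pow]
  have h9 : (3⁻¹ * 3⁻¹ : ℝ≥0∞) = 9⁻¹ := by
    rw [← ENNReal.mul_inv (by simp) (by simp)]
    norm_num
  rw [h9]
  refine mul_le_mul_right ?_ _
  have h3 : ∑ u : Fin n → Fin 3, ∑ v : Fin n → Fin 3, ∫⁻ x, ∫⁻ y,
        G ((x + (wordProj p q u : ℝ) / q) / 2 ^ n)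
          ((y + (wordProj p q v : ℝ) / q) / 2 ^ n) ∂μ ∂μ
      = ∫⁻ z, ∑ u : Fin n → Fin 3, ∑ v : Fin n → Fin 3,
        G ((z.1 + (wordProj p q u : ℝ) / q) / 2 ^ n)
          ((z.2 + (wordProj p q v : ℝ) / q) / 2 ^ n) ∂(μ.prod μ) := by
    rw [lintegral_finsetSum _ fun u _ => Finset.measurable_fun_sum _ fun v _ => hGshift _ _]
    refine Finset.sum_congr rfl fun u _ => ?_
    rw [lintegral_finsetSum _ fun v _ => hGshift _ _]
    refine Finset.sum_congr rfl fun v _ => ?_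
    rw [lintegral_prod _ (hGshift _ _).aemeasurable]
  rw [h3]
  have h4 : ∀ z : ℝ × ℝ, ∑ u : Fin n → Fin 3, ∑ v : Fin n → Fin 3,
        G ((z.1 + (wordProj p q u : ℝ) / q) / 2 ^ n)
          ((z.2 + (wordProj p q v : ℝ) / q) / 2 ^ n)
      ≤ ((2 * q + 1) * collisions p q n : ℕ) := by
    intro z
    refine le_trans (le_of_eq ?_) (Nat.cast_le.2 (sum_close_le p q n hq (z.1 - z.2)))
    push_cast
    refine Finset.sum_congr rfl fun u _ => Finset.sum_congr rfl fun v _ => ?_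
    rw [hGdef]
    have h5 : (z.1 + (wordProj p q u : ℝ) / q) / 2 ^ n - (z.2 + (wordProj p q v : ℝ) / q) / 2 ^ n
        = (z.1 - z.2 + ((wordProj p q u : ℝ) - wordProj p q v) / q) * (2 ^ n)⁻¹ := by
      ring
    have h6 : (0 : ℝ) < (2 ^ n)⁻¹ := by positivity
    simp only [h5, abs_mul, abs_of_pos h6]
    congr 1
    rw [mul_le_iff_le_one_left h6]
  refine (lintegral_mono h4).trans ?_
  simp

lemma hausdorffMeasure_ne_zero_of_closedBall_le (μ : Measure ℝ) (G : Set ℝ)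
    (hG : MeasurableSet G) (hμG : μ G ≠ 0) (s M : ℝ) (hs : 0 < s) (hM : 0 < M) (n₀ : ℕ)
    (hball : ∀ x ∈ G, ∀ n, n₀ ≤ n →
      μ (Metric.closedBall x ((2 : ℝ) ^ n)⁻¹) ≤ ENNReal.ofReal (M * (((2 : ℝ) ^ n)⁻¹) ^ s)) :
    μH[s] G ≠ 0 := by
  have hC : 0 < M * 2 ^ s := by positivity
  have hcover : ∀ S : Set ℝ, Metric.ediam S ≤ ENNReal.ofReal ((2 : ℝ) ^ n₀)⁻¹ →
      μ (S ∩ G) ≤ ENNReal.ofReal (M * 2 ^ s) * Metric.ediam S ^ s := by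
    intro S hS
    rcases (S ∩ G).eq_empty_or_nonempty with h | ⟨x, hxS, hxG⟩
    · simp [h]
    obtain ⟨r, hr⟩ : ∃ r : ℝ, r = (Metric.ediam S).toReal := ⟨_, rfl⟩
    have hr0 : 0 ≤ r := hr ▸ ENNReal.toReal_nonneg
    have hSr : Metric.ediam S = ENNReal.ofReal r := by
      rw [hr, ENNReal.ofReal_toReal (ne_top_of_le_ne_top ENNReal.ofReal_ne_top hS)]
    have hrn : r ≤ ((2 : ℝ) ^ n₀)⁻¹ := by
      rw [hSr] at hS
      exact (ENNReal.ofReal_le_ofReal_iff (by positivity)).1 hS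
    have hsub : ∀ n, n₀ ≤ n → r ≤ ((2 : ℝ) ^ n)⁻¹ →
        μ (S ∩ G) ≤ ENNReal.ofReal (M * (((2 : ℝ) ^ n)⁻¹) ^ s) := by
      intro n hn hrn
      refine (measure_mono fun y hy => ?_).trans (hball x hxG n hn)
      rw [Metric.mem_closedBall]
      have h1 := Metric.edist_le_ediam_of_mem hy.1 hxS
      rw [hSr, edist_dist] at h1
      exact ((ENNReal.ofReal_le_ofReal_iff hr0).1 h1).trans hrn
    rcases hr0.eq_or_lt with h0 | hpos
    · have hlim : Filter.Tendsto (fun n : ℕ => ENNReal.ofReal (M * (((2 : ℝ) ^ n)⁻¹) ^ s))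
          Filter.atTop (nhds 0) := by
        have h1 : Filter.Tendsto (fun n : ℕ => ((2 : ℝ) ^ n)⁻¹) Filter.atTop (nhds 0) := by
          simp only [← inv_pow]
          exact tendsto_pow_atTop_nhds_zero_of_lt_one (by norm_num) (by norm_num)
        have h2 := (h1.rpow_const (p := s) (Or.inr hs.le)).const_mul M
        rw [Real.zero_rpow hs.ne', mul_zero] at h2
        simpa using ENNReal.tendsto_ofReal h2
      have hz : μ (S ∩ G) ≤ 0 := by
        refine ge_of_tendsto hlim ?_
        filter_upwards [Filter.eventually_ge_atTop n₀] with n hn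
        exact hsub n hn (by rw [← h0]; positivity)
      exact hz.trans bot_le
    · obtain ⟨n, hn1, hn2⟩ := exists_nat_pow_near_of_lt_one (y := (2 : ℝ)⁻¹) hpos
        (hrn.trans (inv_le_one_of_one_le₀ (one_le_pow₀ (by norm_num)))) (by norm_num)
        (by norm_num)
      rw [← inv_pow] at hrn
      have hn : n₀ < n + 1 := by
        by_contra hcon
        have := pow_le_pow_of_le_one (a := (2 : ℝ)⁻¹) (by norm_num) (by norm_num)
          (not_lt.1 hcon)
        linarith
      refine (hsub n (Nat.lt_succ_iff.1 hn) (by rwa [← inv_pow])).trans ?_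
      rw [hSr, ENNReal.ofReal_rpow_of_nonneg hr0 hs.le, ← ENNReal.ofReal_mul hC.le]
      refine ENNReal.ofReal_le_ofReal ?_
      rw [mul_assoc, ← Real.mul_rpow (by norm_num) hr0]
      have h2 : ((2 : ℝ) ^ n)⁻¹ ≤ 2 * r := by
        rw [pow_succ, inv_pow] at hn1
        linarith
      gcongr
  have hCne : ENNReal.ofReal (M * 2 ^ s) ≠ 0 := by simpa using hC
  have hle : (ENNReal.ofReal (M * 2 ^ s))⁻¹ • μ.restrict G ≤ μH[s] := by
    refine Measure.le_hausdorffMeasure s _ (ENNReal.ofReal ((2 : ℝ) ^ n₀)⁻¹) (by simp) ?_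
    intro S hS
    rw [Measure.smul_apply, Measure.restrict_apply' hG, smul_eq_mul]
    calc _ ≤ (ENNReal.ofReal (M * 2 ^ s))⁻¹ *
          (ENNReal.ofReal (M * 2 ^ s) * Metric.ediam S ^ s) := by
          gcongr
          exact hcover S hS
      _ = Metric.ediam S ^ s := by
          rw [← mul_assoc, ENNReal.inv_mul_cancel hCne ENNReal.ofReal_ne_top, one_mul]
  intro h0
  have h1 := hle G
  rw [h0, Measure.smul_apply, Measure.restrict_apply' hG, Set.inter_self, smul_eq_mul] at h1
  have h2 := mul_eq_zero.1 (le_antisymm h1 bot_le)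
  rcases h2 with h2 | h2
  · exact ENNReal.inv_ne_zero.2 ENNReal.ofReal_ne_top h2
  · exact hμG h2

lemma le_dimH_of_lintegral_closedBall_le (μ : Measure ℝ) [IsProbabilityMeasure μ]
    (s : NNReal) (hs : 0 < s) (t K : ℝ) (hst : s < t) (n₀ : ℕ)
    (hbound : ∀ n, n₀ ≤ n → ∫⁻ x, μ (Metric.closedBall x ((2 : ℝ) ^ n)⁻¹) ∂μ
      ≤ ENNReal.ofReal (K * (((2 : ℝ) ^ n)⁻¹) ^ t))
    (A : Set ℝ) (hA : MeasurableSet A) (hμA : μ A = 1) : (s : ℝ≥0∞) ≤ dimH A := by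
  obtain ⟨a, ha⟩ : ∃ a : ℕ → ℝ, a = fun n => ((2 : ℝ) ^ (n + n₀))⁻¹ := ⟨_, rfl⟩
  have ha0 : ∀ n, 0 < a n := fun n => by rw [ha]; positivity
  have hmeas : ∀ r : ℝ, Measurable fun x => μ (Metric.closedBall x r) := by
    intro r
    have hS : MeasurableSet {z : ℝ × ℝ | dist z.2 z.1 ≤ r} :=
      measurableSet_le (by fun_prop) (by fun_prop)
    exact measurable_measure_prodMk_left hS
  obtain ⟨E, hE⟩ : ∃ E : ℝ → ℝ≥0∞, E = fun x => ∑' n,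
      ENNReal.ofReal (a n ^ (-(s : ℝ))) * μ (Metric.closedBall x (a n)) := ⟨_, rfl⟩
  have hEm : Measurable E := by
    rw [hE]
    exact Measurable.tsum fun n => (hmeas _).const_mul _
  have hEint : ∫⁻ x, E x ∂μ ≠ ⊤ := by
    rw [hE, lintegral_tsum fun n => ((hmeas _).const_mul _).aemeasurable]
    have hsum : Summable fun n => K * a n ^ (t - s) := by
      refine Summable.mul_left K ?_
      have hρ : ∀ n, a n ^ (t - s) = (((2 : ℝ)⁻¹) ^ (t - s)) ^ (n + n₀) := by
        intro n
        rw [ha]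
        simp only
        rw [← inv_pow, ← Real.rpow_natCast, ← Real.rpow_natCast, ← Real.rpow_mul (by norm_num),
          ← Real.rpow_mul (by norm_num), mul_comm]
      simp only [hρ, pow_add]
      exact (summable_geometric_of_lt_one (by positivity)
        (Real.rpow_lt_one (by norm_num) (by norm_num) (by linarith))).mul_right _
    refine ne_top_of_le_ne_top hsum.tsum_ofReal_ne_top (ENNReal.tsum_le_tsum fun n => ?_)
    rw [lintegral_const_mul _ (hmeas _)]
    have h1 : ∫⁻ x, μ (Metric.closedBall x (a n)) ∂μ ≤ ENNReal.ofReal (K * a n ^ t) := by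
      rw [ha]
      exact hbound (n + n₀) (Nat.le_add_left _ _)
    refine (mul_le_mul_right h1 _).trans ?_
    rw [← ENNReal.ofReal_mul (by have := ha0 n; positivity)]
    refine ENNReal.ofReal_le_ofReal (le_of_eq ?_)
    rw [sub_eq_neg_add, Real.rpow_add (ha0 n)]
    ring
  obtain ⟨m, hm⟩ : ∃ m : ℕ, μ (A ∩ {x | E x ≤ m}) ≠ 0 := by
    by_contra! hcon
    have h1 : μ (⋃ m : ℕ, A ∩ {x | E x ≤ m}) = 0 := measure_iUnion_null hcon
    have h2 : μ {x | ¬ E x < ⊤} = 0 := ae_lt_top hEm hEint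
    have h3 : A ⊆ (⋃ m : ℕ, A ∩ {x | E x ≤ m}) ∪ {x | ¬ E x < ⊤} := by
      intro x hx
      by_cases h : E x < ⊤
      · obtain ⟨m, hm⟩ := ENNReal.exists_nat_gt h.ne
        exact Or.inl (Set.mem_iUnion.2 ⟨m, hx, hm.le⟩)
      · exact Or.inr h
    have h4 := measure_mono_null h3 (measure_union_null h1 h2)
    rw [hμA] at h4
    exact one_ne_zero h4
  have hH := hausdorffMeasure_ne_zero_of_closedBall_le μ (A ∩ {x | E x ≤ m})
    (hA.inter (measurableSet_le hEm measurable_const)) hm s (m + 1) (by exact_mod_cast hs)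
    (by positivity) n₀ ?_
  · refine le_dimH_of_hausdorffMeasure_ne_zero fun h0 => hH ?_
    exact measure_mono_null Set.inter_subset_left h0
  · rintro x ⟨-, hx⟩ n hn
    obtain ⟨k, rfl⟩ := Nat.exists_eq_add_of_le' hn
    have hx' : E x ≤ m := hx
    have h1 : ENNReal.ofReal (a k ^ (-(s : ℝ))) * μ (Metric.closedBall x (a k)) ≤ m := by
      refine le_trans ?_ hx'
      rw [hE]
      exact ENNReal.le_tsum k
    have h2 : a k = ((2 : ℝ) ^ (k + n₀))⁻¹ := by rw [ha]
    rw [← h2]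
    have hpos : 0 < a k ^ (s : ℝ) := Real.rpow_pos_of_pos (ha0 k) _
    calc μ (Metric.closedBall x (a k))
        = ENNReal.ofReal (a k ^ (s : ℝ)) *
          (ENNReal.ofReal (a k ^ (-(s : ℝ))) * μ (Metric.closedBall x (a k))) := by
          rw [← mul_assoc, ← ENNReal.ofReal_mul hpos.le, Real.rpow_neg (ha0 k).le,
            mul_inv_cancel₀ hpos.ne', ENNReal.ofReal_one, one_mul]
      _ ≤ ENNReal.ofReal (a k ^ (s : ℝ)) * ENNReal.ofReal (m + 1) := by
          gcongr
          refine h1.trans ?_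
          rw [← ENNReal.ofReal_natCast]
          exact ENNReal.ofReal_le_ofReal (by linarith)
      _ = ENNReal.ofReal ((m + 1) * a k ^ (s : ℝ)) := by
          rw [← ENNReal.ofReal_mul hpos.le, mul_comm]

/-- every Borel set of full `μ_θ`-measure has Hausdorff dimension at
least `(log 9 - P)/log 2`, where `P` is the topological pressure of `φ` on `l_{p/q}`. -/
theorem stmt_12 (p q : ℕ) (hp : 0 < p) (hq : 0 < q) (hpq : p ≤ q)
    (hcop : Nat.Coprime p q)
    (μ : Measure ℝ) (hprob : IsProbabilityMeasure μ)
    (hself : ∀ A : Set ℝ, MeasurableSet A →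
      μ A = (1 / 3) * (μ ((fun x => 2 * x) '' A) + μ ((fun x => 2 * x - 1) '' A)
        + μ ((fun x => 2 * x - (p : ℝ) / (q : ℝ)) '' A))) :
    ∀ A : Set ℝ, MeasurableSet A → μ A = 1 →
      ENNReal.ofReal ((Real.log 9 - pressure p q) / Real.log 2) ≤ dimH A := by
  intro A hA hμA
  refine ENNReal.le_of_forall_nnreal_lt fun s hs => ?_
  rcases eq_or_ne s 0 with rfl | hs0
  · simp
  have hlog2 : 0 < Real.log 2 := Real.log_pos (by norm_num)
  have hs' : (s : ℝ) < (Real.log 9 - pressure p q) / Real.log 2 := by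
    simpa using (ENNReal.lt_ofReal_iff_toReal_lt ENNReal.coe_ne_top).1 hs
  obtain ⟨t, hst, ht⟩ := exists_between hs'
  rw [lt_div_iff₀ hlog2] at ht
  obtain ⟨n₀, hn₀⟩ := Filter.eventually_atTop.1
    (eventually_collisions_le p q hq (Real.log 9 - t * Real.log 2) (by linarith))
  refine le_dimH_of_lintegral_closedBall_le μ s (pos_iff_ne_zero.2 hs0) t ((2 * q + 1) * 2)
    hst n₀ (fun n hn => ?_) A hA hμA
  refine (lintegral_closedBall_le p q hq μ hself n).trans ?_
  have hexp : Real.exp ((Real.log 9 - t * Real.log 2) * n)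
      = 9 ^ n * (((2 : ℝ) ^ n)⁻¹) ^ t := by
    rw [Real.rpow_def_of_pos (by positivity), Real.log_inv, Real.log_pow,
      ← Real.exp_log (show (0 : ℝ) < 9 ^ n by positivity), ← Real.exp_add, Real.log_pow]
    congr 1
    ring
  have h9 : ((9⁻¹ : ℝ≥0∞) ^ n) = ENNReal.ofReal ((9 ^ n)⁻¹) := by
    rw [ENNReal.ofReal_inv_of_pos (by positivity), ENNReal.ofReal_pow (by norm_num),
      ENNReal.inv_pow]
    norm_num
  rw [h9, ← ENNReal.ofReal_natCast, ← ENNReal.ofReal_mul (by positivity)]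
  refine ENNReal.ofReal_le_ofReal ?_
  rw [inv_mul_le_iff₀ (by positivity)]
  push_cast
  calc (2 * (q : ℝ) + 1) * collisions p q n
      ≤ (2 * q + 1) * (2 * (9 ^ n * (((2 : ℝ) ^ n)⁻¹) ^ t)) := by
        gcongr
        rw [← hexp]
        exact hn₀ n hn
    _ = _ := by ring
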